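/- arXiv:1611.09924 — 2 statements merged into one kernel-verified Lean document; each statement's English description precedes it below -/
import Mathlib

section
/- Let k be a field and a, b natural numbers. The subalgebra k[x_1,...,x_{a+b}]^{S_a × S_b} of polynomials invariant under permutations of the first a variables and of the last b variables is a free module of rank (a+b choose a) over the subalgebra k[x_1,...,x_{a+b}]^{S_{a+b}} of fully symmetric polynomials. -/
open MvPolynomial

/-- The subalgebra of `k[x₁,...,x_{a+b}]` of polynomials invariant under all permutations
preserving the partition of the variables into the first `a` and the last `b`
(i.e. invariant under `S_a × S_b`). -/
noncomputable def partialSym (k : Type) [Field k] (a b : ℕ) :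
    Subalgebra k (MvPolynomial (Fin (a + b)) k) :=
  ⨅ σ ∈ {σ : Equiv.Perm (Fin (a + b)) | ∀ i : Fin (a + b), (i : ℕ) < a → ((σ i : ℕ) < a)},
    AlgHom.equalizer (rename (σ : Fin (a + b) → Fin (a + b)))
      (AlgHom.id k (MvPolynomial (Fin (a + b)) k))

namespace MvPolynomial

variable {k : Type*} [Field k] {V W : Type*}

/-- The subalgebra of polynomials invariant under a group of permutations of the variables. -/
noncomputable def permInvariants (k : Type*) [Field k] (G : Subgroup (Equiv.Perm V)) :
    Subalgebra k (MvPolynomial V k) :=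
  ⨅ g ∈ G, AlgHom.equalizer (rename g) (AlgHom.id k (MvPolynomial V k))

theorem mem_permInvariants {G : Subgroup (Equiv.Perm V)} {f : MvPolynomial V k} :
    f ∈ permInvariants k G ↔ ∀ g ∈ G, rename g f = f := by
  simp [permInvariants, Algebra.mem_iInf, AlgHom.mem_equalizer]

theorem permInvariants_top :
    permInvariants k (⊤ : Subgroup (Equiv.Perm V)) = symmetricSubalgebra V k := by
  ext f
  simp [mem_permInvariants, mem_symmetricSubalgebra, IsSymmetric]

theorem permInvariants_anti {G H : Subgroup (Equiv.Perm V)} (h : G ≤ H) :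
    permInvariants k H ≤ permInvariants k G := fun _ hf =>
  mem_permInvariants.2 fun g hg => mem_permInvariants.1 hf g (h hg)

theorem homogeneousComponent_mem_permInvariants {G : Subgroup (Equiv.Perm V)}
    {f : MvPolynomial V k} (hf : f ∈ permInvariants k G) (n : ℕ) :
    homogeneousComponent n f ∈ permInvariants k G :=
  mem_permInvariants.2 fun g hg => by
    rw [rename_homogeneousComponent, mem_permInvariants.1 hf g hg]

theorem X_dvd_of_killCompl_eq_zero {i : W → V} (hi : Function.Injective i) {v : V}
    (hv : ∀ x, x ∉ Set.range i → x = v) {f : MvPolynomial V k} (hf : killCompl hi f = 0) :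
    X v ∣ f := by
  rw [f.as_sum]
  refine Finset.dvd_sum fun d _ => ?_
  rw [X_dvd_monomial]
  by_contra! h
  have hd : ↑d.support ⊆ Set.range i := by
    intro x hx
    by_contra hxi
    rw [Finset.mem_coe, Finsupp.mem_support_iff, hv x hxi] at hx
    exact hx h.2
  apply h.1
  rw [← Finsupp.mapDomain_comapDomain i hi d hd, ← coeff_killCompl hi, hf, coeff_zero]

theorem killCompl_X_apply {i : W → V} (hi : Function.Injective i) (w : W) :
    killCompl hi (X (i w) : MvPolynomial V k) = X w := by
  rw [← rename_X (R := k) i, killCompl_rename_app]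

theorem killCompl_X_of_notMem {i : W → V} (hi : Function.Injective i) {v : V}
    (hv : v ∉ Set.range i) : killCompl hi (X v : MvPolynomial V k) = 0 := by
  rw [killCompl, aeval_X, dif_neg hv]

theorem exists_eq_prod_X_mul {G : Subgroup (Equiv.Perm V)} {i : W → V}
    (hi : Function.Injective i) {v : V} (hv : ∀ x, x ∉ Set.range i → x = v) (T : Finset V)
    (hT : ∀ g ∈ G, T.map g.toEmbedding = T) (htrans : ∀ t ∈ T, ∃ g ∈ G, g v = t)
    {f : MvPolynomial V k} (hf : f ∈ permInvariants k G) (h0 : killCompl hi f = 0) :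
    ∃ h ∈ permInvariants k G, f = (∏ t ∈ T, X t) * h := by
  have hdvd : (∏ t ∈ T, X t) ∣ f := by
    refine Finset.prod_dvd_of_isRelPrime ?_ ?_
    · intro x _ y _ hxy
      exact (X_prime.irreducible.isRelPrime_iff_not_dvd).2 fun h => hxy (X_dvd_X.1 h)
    · intro t ht
      obtain ⟨g, hg, rfl⟩ := htrans t ht
      have := map_dvd (rename (R := k) g) (X_dvd_of_killCompl_eq_zero hi hv h0)
      rwa [rename_X, mem_permInvariants.1 hf g hg] at this
  obtain ⟨h, rfl⟩ := hdvd
  refine ⟨h, mem_permInvariants.2 fun g hg => ?_, rfl⟩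
  have h1 := mem_permInvariants.1 hf g hg
  have h2 : rename g (∏ t ∈ T, X t : MvPolynomial V k) = ∏ t ∈ T, X t := by
    conv_rhs => rw [← hT g hg]
    simp
  rw [map_mul, h2] at h1
  exact mul_left_cancel₀ (Finset.prod_ne_zero_iff.2 fun t _ => X_ne_zero t) h1

theorem prod_X_mem_permInvariants {G : Subgroup (Equiv.Perm V)} {T : Finset V}
    (hT : ∀ g ∈ G, T.map g.toEmbedding = T) :
    (∏ t ∈ T, X t : MvPolynomial V k) ∈ permInvariants k G := by
  refine mem_permInvariants.2 fun g hg => ?_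
  conv_rhs => rw [← hT g hg]
  simp

theorem killCompl_mem_permInvariants {G : Subgroup (Equiv.Perm V)} {H : Subgroup (Equiv.Perm W)}
    {i : W → V} (hi : Function.Injective i)
    (hext : ∀ h ∈ H, ∃ g ∈ G, ∀ w, g (i w) = i (h w))
    {f : MvPolynomial V k} (hf : f ∈ permInvariants k G) :
    killCompl hi f ∈ permInvariants k H := by
  refine mem_permInvariants.2 fun h hh => ?_
  obtain ⟨g, hg, hgi⟩ := hext h hh
  have key : (rename h).comp (killCompl hi) = (killCompl (R := k) hi).comp (rename g) := by
    refine algHom_ext fun x => ?_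
    by_cases hx : x ∈ Set.range i
    · obtain ⟨w, rfl⟩ := hx
      simp [killCompl_X_apply, hgi]
    · have hgx : g x ∉ Set.range i := by
        rintro ⟨w, hw⟩
        apply hx
        refine ⟨h⁻¹ w, g.injective ?_⟩
        rw [hgi, ← hw]
        simp
      simp [killCompl_X_of_notMem hi hx, killCompl_X_of_notMem hi hgx]
  have := DFunLike.congr_fun key f
  simpa [mem_permInvariants.1 hf g hg] using this

theorem killCompl_esymm [Fintype V] [Fintype W] {i : W → V} (hi : Function.Injective i) (n : ℕ) :
    killCompl hi (esymm V k n) = esymm W k n := by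
  classical
  rw [esymm, esymm, map_sum]
  have hsub : Finset.powersetCard n (Finset.univ.map ⟨i, hi⟩) ⊆
      Finset.powersetCard n (Finset.univ : Finset V) :=
    Finset.powersetCard_mono (Finset.subset_univ _)
  rw [← Finset.sum_subset hsub]
  · rw [Finset.powersetCard_map, Finset.sum_map]
    refine Finset.sum_congr rfl fun t _ => ?_
    simp [Finset.prod_map, killCompl_X_apply]
  · intro t ht hnt
    rw [Finset.mem_powersetCard] at ht hnt
    have : ∃ x ∈ t, x ∉ Set.range i := by
      by_contra! h
      refine hnt ⟨fun x hx => ?_, ht.2⟩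
      obtain ⟨w, rfl⟩ := h x hx
      simp
    obtain ⟨x, hx, hxi⟩ := this
    rw [map_prod]
    exact Finset.prod_eq_zero hx (killCompl_X_of_notMem hi hxi)

theorem exists_killCompl_eq_of_mem_permInvariants_top [Fintype V] [Fintype W] {i : W → V}
    (hi : Function.Injective i) {f : MvPolynomial W k}
    (hf : f ∈ permInvariants k (⊤ : Subgroup (Equiv.Perm W))) :
    ∃ g ∈ permInvariants k (⊤ : Subgroup (Equiv.Perm V)), killCompl hi g = f := by
  rw [permInvariants_top] at hf
  obtain ⟨p, hp⟩ := esymmAlgHom_surjective (σ := W) k le_rfl ⟨f, hf⟩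
  refine ⟨esymmAlgHom V k _ p, ?_, ?_⟩
  · rw [permInvariants_top]
    exact Subtype.property _
  have key : ((killCompl hi).comp (Subalgebra.val _)).comp (esymmAlgHom V k (Fintype.card W)) =
      (Subalgebra.val _).comp (esymmAlgHom W k (Fintype.card W)) := by
    refine algHom_ext fun j => ?_
    simp [esymmAlgHom, killCompl_esymm]
  exact (DFunLike.congr_fun key p).trans (congrArg Subtype.val hp)

/-- `μ` is a basis of the subalgebra `A`, seen as a module over the subalgebra `S`. -/
def IsBasisOver {ι : Type*} (S A : Subalgebra k (MvPolynomial V k))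
    (μ : ι → MvPolynomial V k) : Prop :=
  LinearIndependent S μ ∧ ∀ f, f ∈ Submodule.span S (Set.range μ) ↔ f ∈ A

theorem homogeneousComponent_mul_of_isHomogeneous {p q : MvPolynomial V k} {d : ℕ}
    (hp : p.IsHomogeneous d) (n : ℕ) :
    homogeneousComponent n (q * p) =
      if d ≤ n then homogeneousComponent (n - d) q * p else 0 := by
  conv_lhs => rw [← q.sum_homogeneousComponent, Finset.sum_mul, map_sum]
  have h (i : ℕ) : homogeneousComponent n (homogeneousComponent i q * p) =
      if n = i + d then homogeneousComponent i q * p else 0 :=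
    homogeneousComponent_of_mem ((homogeneousComponent_isHomogeneous i q).mul hp)
  simp_rw [h]
  split_ifs with hd
  · have h2 (i : ℕ) : n = i + d ↔ n - d = i := by omega
    simp_rw [h2, Finset.sum_ite_eq, Finset.mem_range]
    split_ifs with hlt
    · rfl
    · rw [homogeneousComponent_eq_zero _ _ (by omega), zero_mul]
  · exact Finset.sum_eq_zero fun i _ => if_neg (by omega)

theorem homogeneousComponent_mem_span {ι : Type*} {S : Subalgebra k (MvPolynomial V k)}
    (hS : ∀ f ∈ S, ∀ n, homogeneousComponent n f ∈ S) {μ : ι → MvPolynomial V k} {d : ι → ℕ}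
    (hμ : ∀ i, (μ i).IsHomogeneous (d i)) {f : MvPolynomial V k}
    (hf : f ∈ Submodule.span S (Set.range μ)) (n : ℕ) :
    homogeneousComponent n f ∈ Submodule.span S (Set.range μ) := by
  induction hf using Submodule.closure_induction with
  | zero => simp
  | add x y _ _ hx hy => rw [map_add]; exact add_mem hx hy
  | smul_mem c x hx =>
    obtain ⟨i, rfl⟩ := hx
    rw [Subalgebra.smul_def, smul_eq_mul, homogeneousComponent_mul_of_isHomogeneous (hμ i)]
    split_ifs
    · exact Submodule.smul_mem _ (⟨_, hS c c.2 (n - d i)⟩ : S)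
        (Submodule.subset_span (Set.mem_range_self i))
    · exact zero_mem _

theorem mem_span_of_forall_exists_add_mul {ι : Type*} {S A : Subalgebra k (MvPolynomial V k)}
    (hS : ∀ f ∈ S, ∀ n, homogeneousComponent n f ∈ S)
    (hA : ∀ f ∈ A, ∀ n, homogeneousComponent n f ∈ A)
    {μ : ι → MvPolynomial V k} {d : ι → ℕ} (hμ : ∀ i, (μ i).IsHomogeneous (d i))
    {e : MvPolynomial V k} (heS : e ∈ S) {D : ℕ} (he : e.IsHomogeneous D) (hD : 0 < D)
    (h : ∀ f ∈ A, ∃ n ∈ Submodule.span S (Set.range μ), ∃ q ∈ A, f = n + q * e)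
    {f : MvPolynomial V k} (hf : f ∈ A) : f ∈ Submodule.span S (Set.range μ) := by
  have key : ∀ m, ∀ f ∈ A, f.IsHomogeneous m → f ∈ Submodule.span S (Set.range μ) := by
    intro m
    induction m using Nat.strong_induction_on with
    | _ m ih =>
      intro f hf hm
      obtain ⟨n, hn, q, hq, hfe⟩ := h f hf
      rw [← homogeneousComponent_eq_self hm, hfe, map_add,
        homogeneousComponent_mul_of_isHomogeneous he]
      refine add_mem (homogeneousComponent_mem_span hS hμ hn m) ?_
      split_ifs with hle
      · rw [mul_comm]
        exact Submodule.smul_mem _ (⟨e, heS⟩ : S)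
          (ih (m - D) (by omega) _ (hA q hq _) (homogeneousComponent_isHomogeneous _ _))
      · exact zero_mem _
  rw [← f.sum_homogeneousComponent]
  exact sum_mem fun i _ => key i _ (hA f hf i) (homogeneousComponent_isHomogeneous _ _)

theorem linearIndependent_of_forall_exists_mul {ι : Type*} [Fintype ι]
    {S : Subalgebra k (MvPolynomial V k)} {μ : ι → MvPolynomial V k}
    {e : MvPolynomial V k} (he0 : e ≠ 0) {D : ℕ} (he : e.IsHomogeneous D) (hD : 0 < D)
    (h : ∀ c : ι → MvPolynomial V k, (∀ i, c i ∈ S) → ∑ i, c i * μ i = 0 →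
      ∃ c' : ι → MvPolynomial V k, (∀ i, c' i ∈ S) ∧ (∀ i, c i = e * c' i) ∧
        ∑ i, c' i * μ i = 0) : LinearIndependent S μ := by
  have key : ∀ n, ∀ c : ι → MvPolynomial V k, (∀ i, c i ∈ S) → ∑ i, c i * μ i = 0 →
      (∀ i, c i = 0 ∨ (c i).totalDegree < n) → ∀ i, c i = 0 := by
    intro n
    induction n with
    | zero => exact fun c _ _ hn i => (hn i).resolve_right (by omega)
    | succ n ih =>
      intro c hc h0 hn i
      obtain ⟨c', hc', hcc', h0'⟩ := h c hc h0
      rw [hcc' i, ih c' hc' h0' (fun j => ?_) i, mul_zero]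
      by_contra! hj
      have := hn j
      rw [hcc' j, totalDegree_mul_of_isDomain he0 hj.1, he.totalDegree he0] at this
      rcases this with h1 | h1
      · exact mul_ne_zero he0 hj.1 h1
      · omega
  rw [Fintype.linearIndependent_iff]
  intro c hc i
  exact Subtype.ext (key ((Finset.univ.sup fun i => (c i : MvPolynomial V k).totalDegree) + 1)
    (fun i => c i) (fun i => (c i).2) hc
    (fun j => Or.inr (Nat.lt_succ_of_le (Finset.le_sup
      (f := fun i => (c i : MvPolynomial V k).totalDegree) (Finset.mem_univ j)))) i)

/-- The algebra map `φ` carries the pair of subalgebras `S ≤ A` to `S' ≤ A'`, is onto `S'` from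
`S`, and its kernel is generated by `e` on `A` and by `E` on `S`. -/
structure IsReduction (φ : MvPolynomial V k →ₐ[k] MvPolynomial W k)
    (S A : Subalgebra k (MvPolynomial V k)) (S' A' : Subalgebra k (MvPolynomial W k))
    (e E : MvPolynomial V k) : Prop where
  map_left : ∀ f ∈ S, φ f ∈ S'
  map_right : ∀ f ∈ A, φ f ∈ A'
  lift_left : ∀ f ∈ S', ∃ g ∈ S, φ g = f
  map_eq_zero : φ e = 0
  ker_left : ∀ f ∈ S, φ f = 0 → ∃ h ∈ S, f = E * h
  ker_right : ∀ f ∈ A, φ f = 0 → ∃ h ∈ A, f = e * h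

namespace IsReduction

variable {φ : MvPolynomial V k →ₐ[k] MvPolynomial W k} {S A : Subalgebra k (MvPolynomial V k)}
  {S' A' : Subalgebra k (MvPolynomial W k)} {e E : MvPolynomial V k} {ι : Type*}
  {ν : ι → MvPolynomial V k}

theorem exists_mem_span (h : IsReduction φ S A S' A' e E) (hν : IsBasisOver S' A' (φ ∘ ν))
    {f : MvPolynomial V k} (hf : f ∈ A) :
    ∃ n ∈ Submodule.span S (Set.range ν), φ n = φ f := by
  have key : ∀ x ∈ Submodule.span S' (Set.range (φ ∘ ν)),
      ∃ n ∈ Submodule.span S (Set.range ν), φ n = x := by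
    intro x hx
    induction hx using Submodule.closure_induction with
    | zero => exact ⟨0, zero_mem _, map_zero φ⟩
    | add x y _ _ hx hy =>
      obtain ⟨n, hn, rfl⟩ := hx
      obtain ⟨m, hm, rfl⟩ := hy
      exact ⟨n + m, add_mem hn hm, map_add φ n m⟩
    | smul_mem c x hx =>
      obtain ⟨i, rfl⟩ := hx
      obtain ⟨g, hg, hgc⟩ := h.lift_left c c.2
      refine ⟨g * ν i, Submodule.smul_mem _ (⟨g, hg⟩ : S)
        (Submodule.subset_span (Set.mem_range_self i)), ?_⟩
      rw [map_mul, hgc]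
      rfl
  exact key _ ((hν.2 _).2 (h.map_right f hf))

theorem exists_eq_mul [Fintype ι] (h : IsReduction φ S A S' A' e E)
    (hν : IsBasisOver S' A' (φ ∘ ν)) {c : ι → MvPolynomial V k} (hc : ∀ i, c i ∈ S)
    (h0 : φ (∑ i, c i * ν i) = 0) :
    ∃ c' : ι → MvPolynomial V k, (∀ i, c' i ∈ S) ∧ ∀ i, c i = E * c' i := by
  have h1 := Fintype.linearIndependent_iff.1 hν.1 (fun i => ⟨φ (c i), h.map_left _ (hc i)⟩) (by
    simpa [Subalgebra.smul_def] using h0)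
  have h2 (i : ι) := h.ker_left (c i) (hc i) (congrArg Subtype.val (h1 i))
  choose c' hc' hcc' using h2
  exact ⟨c', hc', hcc'⟩

end IsReduction

theorem span_le_of_le {ι : Type*} {S A : Subalgebra k (MvPolynomial V k)} (hSA : S ≤ A)
    {μ : ι → MvPolynomial V k} (hμ : ∀ i, μ i ∈ A) {f : MvPolynomial V k}
    (hf : f ∈ Submodule.span S (Set.range μ)) : f ∈ A := by
  induction hf using Submodule.closure_induction with
  | zero => exact zero_mem _
  | add x y _ _ hx hy => exact add_mem hx hy
  | smul_mem c x hx =>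
    obtain ⟨i, rfl⟩ := hx
    exact mul_mem (hSA c.2) (hμ i)

theorem IsBasisOver.sum_elim {V₁ V₂ ι₁ ι₂ : Type*} [Fintype ι₁] [Fintype ι₂]
    {S A : Subalgebra k (MvPolynomial V k)} (hSA : S ≤ A)
    (hS : ∀ f ∈ S, ∀ n, homogeneousComponent n f ∈ S)
    (hA : ∀ f ∈ A, ∀ n, homogeneousComponent n f ∈ A)
    {S₁ A₁ : Subalgebra k (MvPolynomial V₁ k)} {S₂ A₂ : Subalgebra k (MvPolynomial V₂ k)}
    {φ₁ : MvPolynomial V k →ₐ[k] MvPolynomial V₁ k}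
    {φ₂ : MvPolynomial V k →ₐ[k] MvPolynomial V₂ k} {e₁ e₂ : MvPolynomial V k}
    (h₁ : IsReduction φ₁ S A S₁ A₁ e₂ (e₁ * e₂)) (h₂ : IsReduction φ₂ S A S₂ A₂ e₁ (e₁ * e₂))
    (he₂A : e₂ ∈ A) (heS : e₁ * e₂ ∈ S) (he0 : e₁ * e₂ ≠ 0)
    {D : ℕ} (he : (e₁ * e₂).IsHomogeneous D) (hD : 0 < D)
    {ν : ι₁ → MvPolynomial V k} {ρ : ι₂ → MvPolynomial V k}
    (hνA : ∀ i, ν i ∈ A) (hρA : ∀ i, ρ i ∈ A) {d : ι₁ ⊕ ι₂ → ℕ}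
    (hd : ∀ i, (Sum.elim ν (fun j => ρ j * e₂) i).IsHomogeneous (d i))
    (hν : IsBasisOver S₁ A₁ (φ₁ ∘ ν)) (hρ : IsBasisOver S₂ A₂ (φ₂ ∘ ρ)) :
    IsBasisOver S A (Sum.elim ν (fun j => ρ j * e₂)) := by
  have he₁0 : e₁ ≠ 0 := left_ne_zero_of_mul he0
  have he₂0 : e₂ ≠ 0 := right_ne_zero_of_mul he0
  constructor
  · refine linearIndependent_of_forall_exists_mul he0 he hD fun c hc h0 => ?_
    simp only [Fintype.sum_sum_type, Sum.elim_inl, Sum.elim_inr] at h0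
    have h0₂ : ∑ j, c (.inr j) * (ρ j * e₂) = (∑ j, c (.inr j) * ρ j) * e₂ := by
      simp only [Finset.sum_mul, mul_assoc]
    rw [h0₂] at h0
    obtain ⟨c₁, hc₁, hcc₁⟩ := h₁.exists_eq_mul hν (c := fun i => c (.inl i)) (fun i => hc _) (by
      rw [eq_neg_of_add_eq_zero_left h0, map_neg, map_mul, h₁.map_eq_zero, mul_zero, neg_zero])
    have h0₁ : ∑ i, c (.inl i) * ν i = (e₁ * ∑ i, c₁ i * ν i) * e₂ := by
      simp only [Finset.sum_mul, Finset.mul_sum, hcc₁]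
      exact Finset.sum_congr rfl fun i _ => by ring
    rw [h0₁, ← add_mul] at h0
    replace h0 := (mul_eq_zero.1 h0).resolve_right he₂0
    obtain ⟨c₂, hc₂, hcc₂⟩ := h₂.exists_eq_mul hρ (c := fun i => c (.inr i)) (fun i => hc _) (by
      rw [eq_neg_of_add_eq_zero_right h0, map_neg, map_mul, h₂.map_eq_zero, zero_mul, neg_zero])
    refine ⟨Sum.elim c₁ c₂, by simpa using ⟨hc₁, hc₂⟩, by simpa using ⟨hcc₁, hcc₂⟩, ?_⟩
    refine mul_left_cancel₀ he₁0 ?_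
    rw [mul_zero, ← h0]
    simp only [Fintype.sum_sum_type, Sum.elim_inl, Sum.elim_inr, mul_add, Finset.mul_sum, hcc₂]
    congr 1
    exact Finset.sum_congr rfl fun i _ => by ring
  · intro f
    refine ⟨span_le_of_le hSA ?_, mem_span_of_forall_exists_add_mul hS hA hd heS he hD ?_⟩
    · rintro (i | j)
      exacts [hνA i, mul_mem (hρA j) he₂A]
    · intro f hf
      obtain ⟨n, hn, hnf⟩ := h₁.exists_mem_span hν hf
      obtain ⟨g, hg, hfg⟩ := h₁.ker_right (f - n) (sub_mem hf (span_le_of_le hSA hνA hn))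
        (by rw [map_sub, hnf, sub_self])
      obtain ⟨m, hm, hmg⟩ := h₂.exists_mem_span hρ hg
      obtain ⟨q, hq, hgq⟩ := h₂.ker_right (g - m) (sub_mem hg (span_le_of_le hSA hρA hm))
        (by rw [map_sub, hmg, sub_self])
      refine ⟨n + m * e₂, add_mem ?_ ?_, q, hq, ?_⟩
      · refine Submodule.span_mono ?_ hn
        rintro _ ⟨i, rfl⟩
        exact ⟨.inl i, rfl⟩
      · clear hmg hgq
        induction hm using Submodule.closure_induction with
        | zero => simp
        | add x y _ _ hx hy => rw [add_mul]; exact add_mem hx hy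
        | smul_mem c x hx =>
          obtain ⟨j, rfl⟩ := hx
          rw [smul_mul_assoc]
          exact Submodule.smul_mem _ c (Submodule.subset_span ⟨.inr j, rfl⟩)
      · linear_combination hfg + e₂ * hgq

theorem isReduction_killCompl [Fintype V] [Fintype W] {G : Subgroup (Equiv.Perm V)}
    {H : Subgroup (Equiv.Perm W)} {i : W → V} (hi : Function.Injective i) {v : V}
    (hvi : v ∉ Set.range i) (hv : ∀ x, x ∉ Set.range i → x = v)
    (hext : ∀ h ∈ H, ∃ g ∈ G, ∀ w, g (i w) = i (h w)) {T : Finset V} (hvT : v ∈ T)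
    (hT : ∀ g ∈ G, T.map g.toEmbedding = T) (htrans : ∀ t ∈ T, ∃ g ∈ G, g v = t) :
    IsReduction (killCompl (R := k) hi) (permInvariants k ⊤) (permInvariants k G)
      (permInvariants k ⊤) (permInvariants k H) (∏ t ∈ T, X t) (∏ t, X t) where
  map_left f hf := killCompl_mem_permInvariants hi (fun h _ =>
    ⟨h.viaEmbedding ⟨i, hi⟩, Subgroup.mem_top _, h.viaEmbedding_apply ⟨i, hi⟩⟩) hf
  map_right f hf := killCompl_mem_permInvariants hi hext hf
  lift_left f hf := exists_killCompl_eq_of_mem_permInvariants_top hi hf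
  map_eq_zero := by
    rw [map_prod]
    exact Finset.prod_eq_zero hvT (killCompl_X_of_notMem hi hvi)
  ker_left f hf h0 := by
    classical
    exact exists_eq_prod_X_mul hi hv Finset.univ (fun g _ => Finset.map_univ_equiv g)
      (fun t _ => ⟨Equiv.swap v t, Subgroup.mem_top _, Equiv.swap_apply_left v t⟩) hf h0
  ker_right f hf h0 := exists_eq_prod_X_mul hi hv T hT htrans hf h0

theorem isHomogeneous_esymm [Fintype V] (n : ℕ) : (esymm V k n).IsHomogeneous n := by
  refine IsHomogeneous.sum _ _ _ fun t ht => ?_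
  have := IsHomogeneous.prod t (fun i => (X i : MvPolynomial V k)) (fun _ => 1)
    fun i _ => isHomogeneous_X k i
  simpa [(Finset.mem_powersetCard.1 ht).2] using this

theorem esymm_card [Fintype V] {n : ℕ} (hn : Fintype.card V = n) :
    esymm V k n = ∏ i, X i := by
  rw [← hn, esymm, ← Finset.card_univ, Finset.powersetCard_self, Finset.sum_singleton]

/-- The permutations of `Fin a ⊕ Fin b` preserving both summands. -/
def sumPerms (a b : ℕ) : Subgroup (Equiv.Perm (Fin a ⊕ Fin b)) :=
  (Equiv.Perm.sumCongrHom (Fin a) (Fin b)).range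

/-- The polynomial in the elementary symmetric polynomials of the two groups of variables
given by a polynomial with variables indexed by `ℕ ⊕ ℕ`. -/
noncomputable def esymmPair (k : Type*) [Field k] (a b : ℕ) :
    MvPolynomial (ℕ ⊕ ℕ) k →ₐ[k] MvPolynomial (Fin a ⊕ Fin b) k :=
  aeval (Sum.elim (fun i => rename Sum.inl (esymm (Fin a) k i))
    (fun j => rename Sum.inr (esymm (Fin b) k j)))

theorem esymmPair_mem (a b : ℕ) (q : MvPolynomial (ℕ ⊕ ℕ) k) :
    esymmPair k a b q ∈ permInvariants k (sumPerms a b) := by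
  rw [mem_permInvariants]
  rintro _ ⟨⟨σ, τ⟩, rfl⟩
  have key : (rename (Equiv.Perm.sumCongrHom (Fin a) (Fin b) (σ, τ))).comp (esymmPair k a b) =
      esymmPair k a b := by
    refine algHom_ext fun x => ?_
    rcases x with i | j
    · simp only [esymmPair, AlgHom.comp_apply, aeval_X, Sum.elim_inl, rename_rename]
      conv_rhs => rw [← rename_esymm (Fin a) k i σ, rename_rename]
      rfl
    · simp only [esymmPair, AlgHom.comp_apply, aeval_X, Sum.elim_inr, rename_rename]
      conv_rhs => rw [← rename_esymm (Fin b) k j τ, rename_rename]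
      rfl
  exact DFunLike.congr_fun key q

theorem killCompl_sumMap_esymmPair {a a' b b' : ℕ} {f : Fin a → Fin a'} {g : Fin b → Fin b'}
    (hf : Function.Injective f) (hg : Function.Injective g) (q : MvPolynomial (ℕ ⊕ ℕ) k) :
    killCompl (hf.sumMap hg) (esymmPair k a' b' q) = esymmPair k a b q := by
  have hl : (killCompl (R := k) (hf.sumMap hg)).comp (rename Sum.inl) =
      (rename Sum.inl).comp (killCompl hf) := by
    refine algHom_ext fun x => ?_
    by_cases hx : x ∈ Set.range f
    · obtain ⟨w, rfl⟩ := hx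
      simpa [killCompl_X_apply] using killCompl_X_apply (k := k) (hf.sumMap hg) (.inl w)
    · simp only [AlgHom.comp_apply, rename_X, killCompl_X_of_notMem hf hx, map_zero]
      exact killCompl_X_of_notMem _ (by simpa using hx)
  have hr : (killCompl (R := k) (hf.sumMap hg)).comp (rename Sum.inr) =
      (rename Sum.inr).comp (killCompl hg) := by
    refine algHom_ext fun x => ?_
    by_cases hx : x ∈ Set.range g
    · obtain ⟨w, rfl⟩ := hx
      simpa [killCompl_X_apply] using killCompl_X_apply (k := k) (hf.sumMap hg) (.inr w)
    · simp only [AlgHom.comp_apply, rename_X, killCompl_X_of_notMem hg hx, map_zero]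
      exact killCompl_X_of_notMem _ (by simpa using hx)
  have key : (killCompl (hf.sumMap hg)).comp (esymmPair k a' b') = esymmPair k a b := by
    refine algHom_ext fun x => ?_
    rcases x with i | j
    · simpa [esymmPair, killCompl_esymm] using DFunLike.congr_fun hl (esymm (Fin a') k i)
    · simpa [esymmPair, killCompl_esymm] using DFunLike.congr_fun hr (esymm (Fin b') k j)
  exact DFunLike.congr_fun key q

theorem map_inr_of_mem_sumPerms {a b : ℕ} {g : Equiv.Perm (Fin a ⊕ Fin b)}
    (hg : g ∈ sumPerms a b) :
    (Finset.univ.map Function.Embedding.inr).map g.toEmbedding =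
      Finset.univ.map Function.Embedding.inr := by
  obtain ⟨⟨σ, τ⟩, rfl⟩ := hg
  ext (x | x) <;> simp

theorem map_inl_of_mem_sumPerms {a b : ℕ} {g : Equiv.Perm (Fin a ⊕ Fin b)}
    (hg : g ∈ sumPerms a b) :
    (Finset.univ.map Function.Embedding.inl).map g.toEmbedding =
      Finset.univ.map Function.Embedding.inl := by
  obtain ⟨⟨σ, τ⟩, rfl⟩ := hg
  ext (x | x) <;> simp

theorem isReduction_right (a b : ℕ) :
    IsReduction (killCompl (R := k) (Function.injective_id.sumMap (Fin.succ_injective b)))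
      (permInvariants k ⊤) (permInvariants k (sumPerms a (b + 1)))
      (permInvariants k ⊤) (permInvariants k (sumPerms a b))
      (∏ j, X (Sum.inr j)) ((∏ i, X (Sum.inl i)) * ∏ j, X (Sum.inr j)) := by
  have := isReduction_killCompl (k := k) (G := sumPerms a (b + 1)) (H := sumPerms a b)
    (Function.injective_id.sumMap (Fin.succ_injective b)) (v := Sum.inr 0)
    (T := Finset.univ.map Function.Embedding.inr) (by simp [Fin.succ_ne_zero]) ?_ ?_ (by simp)
    (fun g => map_inr_of_mem_sumPerms) ?_
  · simpa [Fintype.prod_sum_type] using this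
  · rintro (x | x) hx
    · simp at hx
    · induction x using Fin.cases <;> simp at hx ⊢
  · rintro _ ⟨⟨σ, τ⟩, rfl⟩
    refine ⟨_, ⟨⟨σ, τ.viaEmbedding (Fin.succEmb b)⟩, rfl⟩, ?_⟩
    rintro (x | x)
    · simp
    · simpa using τ.viaEmbedding_apply (Fin.succEmb b) x
  · intro t ht
    obtain ⟨j, rfl⟩ : ∃ j, Sum.inr j = t := by simpa using ht
    exact ⟨_, ⟨⟨1, Equiv.swap 0 j⟩, rfl⟩, by simp⟩

theorem isReduction_left (a b : ℕ) :
    IsReduction (killCompl (R := k) ((Fin.succ_injective a).sumMap Function.injective_id))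
      (permInvariants k ⊤) (permInvariants k (sumPerms (a + 1) b))
      (permInvariants k ⊤) (permInvariants k (sumPerms a b))
      (∏ i, X (Sum.inl i)) ((∏ i, X (Sum.inl i)) * ∏ j, X (Sum.inr j)) := by
  have := isReduction_killCompl (k := k) (G := sumPerms (a + 1) b) (H := sumPerms a b)
    ((Fin.succ_injective a).sumMap Function.injective_id) (v := Sum.inl 0)
    (T := Finset.univ.map Function.Embedding.inl) (by simp [Fin.succ_ne_zero]) ?_ ?_ (by simp)
    (fun g => map_inl_of_mem_sumPerms) ?_
  · simpa [Fintype.prod_sum_type] using this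
  · rintro (x | x) hx
    · induction x using Fin.cases <;> simp at hx ⊢
    · simp at hx
  · rintro _ ⟨⟨σ, τ⟩, rfl⟩
    refine ⟨_, ⟨⟨σ.viaEmbedding (Fin.succEmb a), τ⟩, rfl⟩, ?_⟩
    rintro (x | x)
    · simpa using σ.viaEmbedding_apply (Fin.succEmb a) x
    · simp
  · intro t ht
    obtain ⟨j, rfl⟩ : ∃ j, Sum.inl j = t := by simpa using ht
    exact ⟨_, ⟨⟨Equiv.swap 0 j, 1⟩, rfl⟩, by simp⟩

theorem isBasisOver_one (S : Subalgebra k (MvPolynomial V k)) :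
    IsBasisOver S S (fun _ : Unit => (1 : MvPolynomial V k)) := by
  refine ⟨Fintype.linearIndependent_iff.2 fun c hc i => ?_, fun f => ?_⟩
  · simpa [Subalgebra.smul_def] using hc
  · rw [Set.range_const, Submodule.mem_span_singleton]
    constructor
    · rintro ⟨c, rfl⟩
      simp [Subalgebra.smul_def]
    · exact fun hf => ⟨⟨f, hf⟩, by simp [Subalgebra.smul_def]⟩

theorem exists_isBasisOver_of_sumPerms_eq_top {a b : ℕ} (h : sumPerms a b = ⊤)
    (hc : (a + b).choose a = 1) :
    ∃ (ι : Type) (_ : Fintype ι) (q : ι → MvPolynomial (ℕ ⊕ ℕ) k) (d : ι → ℕ),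
      Fintype.card ι = (a + b).choose a ∧
      (∀ i a' b', (esymmPair k a' b' (q i)).IsHomogeneous (d i)) ∧
      IsBasisOver (permInvariants k ⊤) (permInvariants k (sumPerms a b))
        (esymmPair k a b ∘ q) := by
  refine ⟨Unit, inferInstance, fun _ => 1, fun _ => 0, by simp [hc], fun _ a' b' => ?_, ?_⟩
  · rw [map_one]
    exact isHomogeneous_one _ _
  · rw [h]
    convert isBasisOver_one (k := k) (permInvariants k (⊤ : Subgroup (Equiv.Perm (Fin a ⊕ Fin b))))
    simp

theorem exists_isBasisOver_sumPerms (k : Type*) [Field k] (a b : ℕ) :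
    ∃ (ι : Type) (_ : Fintype ι) (q : ι → MvPolynomial (ℕ ⊕ ℕ) k) (d : ι → ℕ),
      Fintype.card ι = (a + b).choose a ∧
      (∀ i a' b', (esymmPair k a' b' (q i)).IsHomogeneous (d i)) ∧
      IsBasisOver (permInvariants k ⊤) (permInvariants k (sumPerms a b))
        (esymmPair k a b ∘ q) := by
  induction a generalizing b with
  | zero =>
    refine exists_isBasisOver_of_sumPerms_eq_top (eq_top_iff.2 fun g _ =>
      Equiv.Perm.mem_sumCongrHom_range_of_perm_mapsTo_inl ?_) (by simp)
    rintro _ ⟨x, _⟩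
    exact x.elim0
  | succ a iha =>
    induction b with
    | zero =>
      refine exists_isBasisOver_of_sumPerms_eq_top (eq_top_iff.2 fun g _ =>
        Equiv.Perm.mem_sumCongrHom_range_of_perm_mapsTo_inl ?_) (by simp)
      rintro x _
      rcases g x with y | y
      · exact ⟨y, rfl⟩
      · exact y.elim0
    | succ b ihb =>
      obtain ⟨ι₁, _, q₁, d₁, hcard₁, hd₁, hq₁⟩ := ihb
      obtain ⟨ι₂, _, q₂, d₂, hcard₂, hd₂, hq₂⟩ := iha (b + 1)
      have hX (a' b' : ℕ) : (esymmPair k a' b' (X (.inr (b + 1)))).IsHomogeneous (b + 1) := by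
        simpa [esymmPair] using (isHomogeneous_esymm (b + 1)).rename_isHomogeneous
      have hd : ∀ i a' b', (esymmPair k a' b' (Sum.elim q₁ (fun j => q₂ j * X (.inr (b + 1))) i)
          ).IsHomogeneous (Sum.elim d₁ (fun j => d₂ j + (b + 1)) i) := by
        rintro (i | j) a' b'
        · exact hd₁ i a' b'
        · simpa using (hd₂ j a' b').mul (hX a' b')
      refine ⟨ι₁ ⊕ ι₂, inferInstance, _, _, ?_, hd, ?_⟩
      · rw [Fintype.card_sum, hcard₁, hcard₂, add_comm,
          show a + 1 + (b + 1) = a + (b + 1) + 1 by ring, Nat.choose_succ_succ,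
          show a + 1 + b = a + (b + 1) by ring]
      · have hE : esymmPair k (a + 1) (b + 1) (X (.inr (b + 1))) = ∏ j, X (Sum.inr j) := by
          simp [esymmPair, esymm_card]
        have hfun : esymmPair k (a + 1) (b + 1) ∘ Sum.elim q₁ (fun j => q₂ j * X (.inr (b + 1))) =
            Sum.elim (esymmPair k (a + 1) (b + 1) ∘ q₁)
              (fun j => esymmPair k (a + 1) (b + 1) (q₂ j) * ∏ j, X (Sum.inr j)) := by
          ext1 (i | j) <;> simp [hE]
        have hprod : (∏ i : Fin (a + 1), X (Sum.inl i)) * (∏ j : Fin (b + 1), X (Sum.inr j)) =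
            ∏ x, (X x : MvPolynomial (Fin (a + 1) ⊕ Fin (b + 1)) k) :=
          (Fintype.prod_sum_type _).symm
        rw [hfun]
        refine IsBasisOver.sum_elim (permInvariants_anti le_top)
          (fun f => homogeneousComponent_mem_permInvariants)
          (fun f => homogeneousComponent_mem_permInvariants)
          (isReduction_right (a + 1) b) (isReduction_left a (b + 1))
          (hE ▸ esymmPair_mem _ _ _) ?_ ?_ (D := Fintype.card (Fin (a + 1) ⊕ Fin (b + 1))) ?_ ?_
          (fun i => esymmPair_mem _ _ _) (fun i => esymmPair_mem _ _ _)
          (d := Sum.elim d₁ (fun j => d₂ j + (b + 1))) ?_ ?_ ?_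
        · rw [hprod]
          exact prod_X_mem_permInvariants fun g _ => Finset.map_univ_equiv g
        · rw [hprod]
          exact Finset.prod_ne_zero_iff.2 fun t _ => X_ne_zero t
        · rw [hprod, ← esymm_card rfl]
          exact isHomogeneous_esymm _
        · simp
        · intro i
          rw [← hfun]
          exact hd i _ _
        · convert hq₁ using 1
          ext1 i
          exact killCompl_sumMap_esymmPair Function.injective_id (Fin.succ_injective b) (q₁ i)
        · convert hq₂ using 1
          ext1 i
          exact killCompl_sumMap_esymmPair (Fin.succ_injective a) Function.injective_id (q₂ i)

theorem mem_partialSym_iff {k : Type} [Field k] {a b : ℕ} {f : MvPolynomial (Fin (a + b)) k} :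
    f ∈ partialSym k a b ↔
      rename finSumFinEquiv.symm f ∈ permInvariants k (sumPerms a b) := by
  have hmem : f ∈ partialSym k a b ↔ ∀ σ : Equiv.Perm (Fin (a + b)),
      (∀ i : Fin (a + b), (i : ℕ) < a → (σ i : ℕ) < a) → rename σ f = f := by
    simp [partialSym, Algebra.mem_iInf, AlgHom.mem_equalizer]
  rw [hmem, mem_permInvariants]
  constructor
  · rintro h _ ⟨⟨σ, τ⟩, rfl⟩
    have h1 := h ((finSumFinEquiv.symm.trans (Equiv.sumCongr σ τ)).trans finSumFinEquiv) ?_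
    · conv_rhs => rw [← h1, rename_rename]
      rw [rename_rename]
      congr 2
      ext1 x
      simp
    · intro i hi
      induction i using Fin.addCases with
      | left i => simp
      | right i => simp at hi
  · intro h σ hσ
    have hσ' : (finSumFinEquiv.trans σ).trans finSumFinEquiv.symm ∈ sumPerms a b := by
      refine Equiv.Perm.mem_sumCongrHom_range_of_perm_mapsTo_inl ?_
      rintro _ ⟨i, rfl⟩
      have := hσ (Fin.castAdd b i) (by simp)
      refine ⟨⟨_, this⟩, ?_⟩
      rw [← finSumFinEquiv.injective.eq_iff]
      ext
      simp
    have h1 := h _ hσ'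
    rw [rename_rename] at h1
    apply rename_injective _ finSumFinEquiv.symm.injective
    rw [rename_rename, ← h1]
    congr 2
    ext1 x
    simp

end MvPolynomial

/-- `k[x₁,...,x_{a+b}]^{S_a × S_b}` is a free module of rank `(a+b choose a)`
over the subalgebra `k[x₁,...,x_{a+b}]^{S_{a+b}}` of fully symmetric polynomials:
there is a family of `(a+b).choose a` elements of the partially symmetric subalgebra such
that every partially symmetric polynomial is a unique linear combination of them with
fully symmetric coefficients. -/
theorem stmt_2 (k : Type) [Field k] (a b : ℕ) :
    ∃ μ : Fin ((a + b).choose a) → MvPolynomial (Fin (a + b)) k,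
      (∀ j, μ j ∈ partialSym k a b) ∧
      ∀ f ∈ partialSym k a b,
        ∃! c : Fin ((a + b).choose a) → symmetricSubalgebra (Fin (a + b)) k,
          f = ∑ j, (c j : MvPolynomial (Fin (a + b)) k) * μ j := by
  obtain ⟨ι, _, q, d, hcard, -, hind, hspan⟩ := exists_isBasisOver_sumPerms k a b
  rw [permInvariants_top] at hind hspan
  let ε : ι ≃ Fin ((a + b).choose a) := Fintype.equivFinOfCardEq hcard
  let φ := renameEquiv k (finSumFinEquiv (m := a) (n := b))
  have hφ (f) : rename finSumFinEquiv.symm f = φ.symm f := rfl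
  let ψ := renameSymmetricSubalgebra (R := k) (finSumFinEquiv (m := a) (n := b))
  have hψ (c) : (ψ c : MvPolynomial (Fin (a + b)) k) = φ c := rfl
  refine ⟨fun j => φ (esymmPair k a b (q (ε.symm j))), fun j => ?_, fun f hf => ?_⟩
  · rw [mem_partialSym_iff, hφ, AlgEquiv.symm_apply_apply]
    exact esymmPair_mem _ _ _
  · rw [mem_partialSym_iff, ← hspan, Submodule.mem_span_range_iff_exists_fun] at hf
    obtain ⟨c, hc⟩ := hf
    have hsum (c' : ι → symmetricSubalgebra (Fin a ⊕ Fin b) k) :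
        ∑ j, (ψ (c' (ε.symm j)) : MvPolynomial (Fin (a + b)) k) *
          φ (esymmPair k a b (q (ε.symm j))) = φ (∑ i, c' i • (esymmPair k a b ∘ q) i) := by
      rw [map_sum, ← ε.symm.sum_comp]
      simp [hψ, Subalgebra.smul_def]
    refine ⟨fun j => ψ (c (ε.symm j)), ?_, fun c' hc' => ?_⟩
    · simp only [hsum, hc, hφ, AlgEquiv.apply_symm_apply]
    · have h1 : ∑ i, ψ.symm (c' (ε i)) • (esymmPair k a b ∘ q) i = φ.symm f := by
        rw [AlgEquiv.eq_symm_apply, ← hsum, hc']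
        simp
      have h2 := (Fintype.linearIndependent_iffₛ.1 hind) (fun i => ψ.symm (c' (ε i))) c
        (h1.trans hc.symm)
      ext1 j
      rw [← h2]
      simp
end

section
/- Let k be a field and R_1, R_2, R_3, C commutative k-algebras. For a module P over R_1 ⊗_k R_2, let Ψ_C(P) = P ⊗_k C, a module over (R_1 ⊗_k C) ⊗_k (R_2 ⊗_k C) on which both copies of C act through the factor C. For a module Q over (R_2 ⊗_k C) ⊗_k (R_3 ⊗_k C), let Ψ'_C(Q) = Q ⊗_{C ⊗_k C} C, a module over R_2 ⊗_k R_3 (coequalizing the two C-actions). Then there is a natural isomorphism Ψ'_C( Ψ_C(P) ⊗_{R_2 ⊗_k C} Q ) ≅ P ⊗_{R_2} Ψ'_C(Q) of modules over R_1 ⊗_k R_3. -/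
set_option synthInstance.maxHeartbeats 1000000
set_option maxHeartbeats 1000000

open TensorProduct

section PartialTrace

variable {k R₁ R₂ R₃ C P Q : Type}
  [CommRing k] [CommRing R₁] [Algebra k R₁] [CommRing R₂] [Algebra k R₂]
  [CommRing R₃] [Algebra k R₃] [CommRing C] [Algebra k C]
  [AddCommGroup P] [AddCommGroup Q] [Module k P] [Module R₂ P]
  [Module ((R₂ ⊗[k] C) ⊗[k] (R₃ ⊗[k] C)) Q]
  [Module (R₂ ⊗[k] C) Q] [Module (C ⊗[k] C) Q] [Module (C ⊗[k] C) C]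
  [Module (R₂ ⊗[k] C) (P ⊗[k] C)]
  [Module (C ⊗[k] C) ((P ⊗[k] C) ⊗[R₂ ⊗[k] C] Q)]
  [Module R₂ (Q ⊗[C ⊗[k] C] C)]

/-- The comparison map `((p ⊗ d) ⊗ q) ⊗ e ↦ p ⊗ (d q ⊗ e)` from the partial trace of a convolution
to the convolution with a partial trace. -/
theorem exists_partialTrace_convolution_hom
    (hk : ∀ (a : k) (p : P), a • p = algebraMap k R₂ a • p)
    (hQ : ∀ (x : R₂ ⊗[k] C) (q : Q), x • q = (x ⊗ₜ[k] (1 : R₃ ⊗[k] C)) • q)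
    (hCQ : ∀ (c c' : C) (q : Q),
      (c ⊗ₜ[k] c') • q = (((1 : R₂) ⊗ₜ[k] c) ⊗ₜ[k] ((1 : R₃) ⊗ₜ[k] c')) • q)
    (hPC : ∀ (r : R₂) (c : C) (p : P) (d : C),
      (r ⊗ₜ[k] c) • (p ⊗ₜ[k] d) = (r • p) ⊗ₜ[k] (c * d))
    (hM : ∀ (c c' : C) (p : P) (d : C) (q : Q),
      (c ⊗ₜ[k] c') • ((p ⊗ₜ[k] d) ⊗ₜ[R₂ ⊗[k] C] q) =
        (p ⊗ₜ[k] (c * d)) ⊗ₜ[R₂ ⊗[k] C]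
          ((((1 : R₂) ⊗ₜ[k] (1 : C)) ⊗ₜ[k] ((1 : R₃) ⊗ₜ[k] c')) • q))
    (hN : ∀ (r : R₂) (q : Q) (e : C),
      r • (q ⊗ₜ[C ⊗[k] C] e) =
        (((r ⊗ₜ[k] (1 : C)) ⊗ₜ[k] ((1 : R₃) ⊗ₜ[k] (1 : C))) • q) ⊗ₜ[C ⊗[k] C] e) :
    ∃ F : ((P ⊗[k] C) ⊗[R₂ ⊗[k] C] Q) ⊗[C ⊗[k] C] C →+ P ⊗[R₂] (Q ⊗[C ⊗[k] C] C),
      ∀ (p : P) (d : C) (q : Q) (e : C),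
        F (((p ⊗ₜ[k] d) ⊗ₜ[R₂ ⊗[k] C] q) ⊗ₜ[C ⊗[k] C] e) =
          p ⊗ₜ[R₂] (((((1 : R₂) ⊗ₜ[k] d) ⊗ₜ[k] (1 : R₃ ⊗[k] C)) • q) ⊗ₜ[C ⊗[k] C] e) := by
  let f : P →+ C →+ Q →+ C →+ P ⊗[R₂] (Q ⊗[C ⊗[k] C] C) :=
    AddMonoidHom.mk' (fun p => AddMonoidHom.mk' (fun d => AddMonoidHom.mk' (fun q =>
      AddMonoidHom.mk' (fun e =>
        p ⊗ₜ[R₂] (((((1 : R₂) ⊗ₜ[k] d) ⊗ₜ[k] (1 : R₃ ⊗[k] C)) • q) ⊗ₜ[C ⊗[k] C] e))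
        fun _ _ => by simp only [tmul_add])
        fun _ _ => by ext; simp [smul_add, add_tmul, tmul_add])
        fun _ _ => by ext; simp [add_smul, add_tmul, tmul_add])
        fun _ _ => by ext; simp [add_tmul]
  have hf (p : P) (d : C) (q : Q) (e : C) : f p d q e =
      p ⊗ₜ[R₂] (((((1 : R₂) ⊗ₜ[k] d) ⊗ₜ[k] (1 : R₃ ⊗[k] C)) • q) ⊗ₜ[C ⊗[k] C] e) := rfl
  let f₁ := liftAddHom (R := k) f fun a p d => by
    ext q e
    rw [hf, hf, hk, smul_tmul, hN, smul_smul, ← Algebra.TensorProduct.one_def,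
      Algebra.TensorProduct.tmul_mul_tmul, Algebra.TensorProduct.tmul_mul_tmul, mul_one, one_mul,
      mul_one, Algebra.algebraMap_eq_smul_one, TensorProduct.smul_tmul (R := k) a (1 : R₂) d]
  have hf₁ (p : P) (d : C) : f₁ (p ⊗ₜ d) = f p d := rfl
  let f₂ := liftAddHom (R := R₂ ⊗[k] C) f₁ fun x y q => by
    induction x with
    | zero => simp
    | add x x' hx hx' => simp only [add_smul, map_add, AddMonoidHom.add_apply, hx, hx']
    | tmul r c =>
      induction y with
      | zero => simp
      | add y y' hy hy' => simp only [smul_add, map_add, AddMonoidHom.add_apply, hy, hy']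
      | tmul p d =>
        ext e
        rw [hPC, hf₁, hf₁, hf, hf, smul_tmul, hN, hQ, smul_smul, smul_smul,
          ← Algebra.TensorProduct.one_def]
        simp only [Algebra.TensorProduct.tmul_mul_tmul, mul_one, mul_comm]
  have hf₂ (y : P ⊗[k] C) (q : Q) : f₂ (y ⊗ₜ q) = f₁ y q := rfl
  refine ⟨liftAddHom (R := C ⊗[k] C) f₂ fun x m e => ?_, fun p d q e => rfl⟩
  induction x with
  | zero => simp
  | add x x' hx hx' => simp only [add_smul, map_add, AddMonoidHom.add_apply, hx, hx']
  | tmul c c' =>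
    induction m with
    | zero => simp
    | add m m' hm hm' => simp only [smul_add, map_add, AddMonoidHom.add_apply, hm, hm']
    | tmul y q =>
      induction y with
      | zero => simp
      | add y y' hy hy' =>
        simp only [add_tmul, smul_add, map_add, AddMonoidHom.add_apply, hy, hy']
      | tmul p d =>
        rw [hM, hf₂, hf₂, hf₁, hf₁, hf, hf, ← smul_tmul, hCQ, smul_smul, smul_smul]
        simp only [Algebra.TensorProduct.tmul_mul_tmul, mul_one, one_mul,
          Algebra.TensorProduct.one_def]

/-- The comparison map `p ⊗ (q ⊗ e) ↦ ((p ⊗ 1) ⊗ q) ⊗ e` from the convolution with a partial trace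
to the partial trace of a convolution. -/
theorem exists_convolution_partialTrace_hom
    (hQ : ∀ (x : R₂ ⊗[k] C) (q : Q), x • q = (x ⊗ₜ[k] (1 : R₃ ⊗[k] C)) • q)
    (hCQ : ∀ (c c' : C) (q : Q),
      (c ⊗ₜ[k] c') • q = (((1 : R₂) ⊗ₜ[k] c) ⊗ₜ[k] ((1 : R₃) ⊗ₜ[k] c')) • q)
    (hPC : ∀ (r : R₂) (c : C) (p : P) (d : C),
      (r ⊗ₜ[k] c) • (p ⊗ₜ[k] d) = (r • p) ⊗ₜ[k] (c * d))
    (hM : ∀ (c c' : C) (p : P) (d : C) (q : Q),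
      (c ⊗ₜ[k] c') • ((p ⊗ₜ[k] d) ⊗ₜ[R₂ ⊗[k] C] q) =
        (p ⊗ₜ[k] (c * d)) ⊗ₜ[R₂ ⊗[k] C]
          ((((1 : R₂) ⊗ₜ[k] (1 : C)) ⊗ₜ[k] ((1 : R₃) ⊗ₜ[k] c')) • q))
    (hN : ∀ (r : R₂) (q : Q) (e : C),
      r • (q ⊗ₜ[C ⊗[k] C] e) =
        (((r ⊗ₜ[k] (1 : C)) ⊗ₜ[k] ((1 : R₃) ⊗ₜ[k] (1 : C))) • q) ⊗ₜ[C ⊗[k] C] e) :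
    ∃ G : P ⊗[R₂] (Q ⊗[C ⊗[k] C] C) →+ ((P ⊗[k] C) ⊗[R₂ ⊗[k] C] Q) ⊗[C ⊗[k] C] C,
      ∀ (p : P) (q : Q) (e : C),
        G (p ⊗ₜ[R₂] (q ⊗ₜ[C ⊗[k] C] e)) =
          ((p ⊗ₜ[k] (1 : C)) ⊗ₜ[R₂ ⊗[k] C] q) ⊗ₜ[C ⊗[k] C] e := by
  let g : Q →+ C →+ P →+ ((P ⊗[k] C) ⊗[R₂ ⊗[k] C] Q) ⊗[C ⊗[k] C] C :=
    AddMonoidHom.mk' (fun q => AddMonoidHom.mk' (fun e => AddMonoidHom.mk' (fun p : P =>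
        ((p ⊗ₜ[k] (1 : C)) ⊗ₜ[R₂ ⊗[k] C] q) ⊗ₜ[C ⊗[k] C] e)
        fun _ _ => by simp only [add_tmul])
        fun _ _ => by ext; simp [tmul_add])
        fun _ _ => by ext; simp [add_tmul, tmul_add]
  have hg (p : P) (q : Q) (e : C) :
      g q e p = ((p ⊗ₜ[k] (1 : C)) ⊗ₜ[R₂ ⊗[k] C] q) ⊗ₜ[C ⊗[k] C] e := rfl
  let g₁ := liftAddHom (R := C ⊗[k] C) g fun x q e => by
    induction x with
    | zero => simp
    | add x x' hx hx' => simp only [add_smul, map_add, AddMonoidHom.add_apply, hx, hx']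
    | tmul c c' =>
      ext p
      have hp : p ⊗ₜ[k] (c * 1) = ((1 : R₂) ⊗ₜ[k] c) • (p ⊗ₜ[k] (1 : C)) := by
        rw [hPC, one_smul]
      rw [hg, hg, ← TensorProduct.smul_tmul (c ⊗ₜ[k] c') ((p ⊗ₜ[k] (1 : C)) ⊗ₜ[R₂ ⊗[k] C] q) e,
        hM, hCQ, hp, smul_tmul, hQ, smul_smul]
      simp only [Algebra.TensorProduct.tmul_mul_tmul, mul_one, one_mul]
  have hg₁ (q : Q) (e : C) : g₁ (q ⊗ₜ e) = g q e := rfl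
  refine ⟨liftAddHom (R := R₂) g₁.flip fun r p z => ?_, fun p q e => rfl⟩
  induction z with
  | zero => simp
  | add z z' hz hz' => simp only [smul_add, map_add, hz, hz']
  | tmul q e =>
    rw [AddMonoidHom.flip_apply, AddMonoidHom.flip_apply, hN, hg₁, hg₁, hg, hg,
      ← mul_one (1 : C), ← hPC, smul_tmul, hQ, mul_one, Algebra.TensorProduct.one_def]

/-- Closing off a strand commutes with convolution by a kernel not involving that strand. -/
theorem nonempty_partialTrace_convolution_equiv [Module R₁ P]
    [Module (R₁ ⊗[k] R₃) (((P ⊗[k] C) ⊗[R₂ ⊗[k] C] Q) ⊗[C ⊗[k] C] C)]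
    [Module (R₁ ⊗[k] R₃) (P ⊗[R₂] (Q ⊗[C ⊗[k] C] C))]
    (hk : ∀ (a : k) (p : P), a • p = algebraMap k R₂ a • p)
    (hQ : ∀ (x : R₂ ⊗[k] C) (q : Q), x • q = (x ⊗ₜ[k] (1 : R₃ ⊗[k] C)) • q)
    (hCQ : ∀ (c c' : C) (q : Q),
      (c ⊗ₜ[k] c') • q = (((1 : R₂) ⊗ₜ[k] c) ⊗ₜ[k] ((1 : R₃) ⊗ₜ[k] c')) • q)
    (hPC : ∀ (r : R₂) (c : C) (p : P) (d : C),
      (r ⊗ₜ[k] c) • (p ⊗ₜ[k] d) = (r • p) ⊗ₜ[k] (c * d))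
    (hM : ∀ (c c' : C) (p : P) (d : C) (q : Q),
      (c ⊗ₜ[k] c') • ((p ⊗ₜ[k] d) ⊗ₜ[R₂ ⊗[k] C] q) =
        (p ⊗ₜ[k] (c * d)) ⊗ₜ[R₂ ⊗[k] C]
          ((((1 : R₂) ⊗ₜ[k] (1 : C)) ⊗ₜ[k] ((1 : R₃) ⊗ₜ[k] c')) • q))
    (hL : ∀ (r₁ : R₁) (r₃ : R₃) (p : P) (d : C) (q : Q) (e : C),
      (r₁ ⊗ₜ[k] r₃) • (((p ⊗ₜ[k] d) ⊗ₜ[R₂ ⊗[k] C] q) ⊗ₜ[C ⊗[k] C] e) =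
        (((r₁ • p) ⊗ₜ[k] d) ⊗ₜ[R₂ ⊗[k] C]
          ((((1 : R₂) ⊗ₜ[k] (1 : C)) ⊗ₜ[k] (r₃ ⊗ₜ[k] (1 : C))) • q)) ⊗ₜ[C ⊗[k] C] e)
    (hN : ∀ (r : R₂) (q : Q) (e : C),
      r • (q ⊗ₜ[C ⊗[k] C] e) =
        (((r ⊗ₜ[k] (1 : C)) ⊗ₜ[k] ((1 : R₃) ⊗ₜ[k] (1 : C))) • q) ⊗ₜ[C ⊗[k] C] e)
    (hR : ∀ (r₁ : R₁) (r₃ : R₃) (p : P) (q : Q) (e : C),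
      (r₁ ⊗ₜ[k] r₃) • (p ⊗ₜ[R₂] (q ⊗ₜ[C ⊗[k] C] e)) =
        (r₁ • p) ⊗ₜ[R₂]
          (((((1 : R₂) ⊗ₜ[k] (1 : C)) ⊗ₜ[k] (r₃ ⊗ₜ[k] (1 : C))) • q) ⊗ₜ[C ⊗[k] C] e)) :
    Nonempty ((((P ⊗[k] C) ⊗[R₂ ⊗[k] C] Q) ⊗[C ⊗[k] C] C) ≃ₗ[R₁ ⊗[k] R₃]
      (P ⊗[R₂] (Q ⊗[C ⊗[k] C] C))) := by
  obtain ⟨F, hF⟩ := exists_partialTrace_convolution_hom hk hQ hCQ hPC hM hN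
  obtain ⟨G, hG⟩ := exists_convolution_partialTrace_hom hQ hCQ hPC hM hN
  have hsmul (a : R₁ ⊗[k] R₃) (x : ((P ⊗[k] C) ⊗[R₂ ⊗[k] C] Q) ⊗[C ⊗[k] C] C) :
      F (a • x) = a • F x := by
    induction a with
    | zero => simp
    | add a b ha hb => simp only [add_smul, map_add, ha, hb]
    | tmul r₁ r₃ =>
      induction x with
      | zero => simp
      | add x y hx hy => simp only [smul_add, map_add, hx, hy]
      | tmul m e =>
        induction m with
        | zero => simp
        | add m n hm hn => simp only [add_tmul, smul_add, map_add, hm, hn]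
        | tmul y q =>
          induction y with
          | zero => simp
          | add y z hy hz => simp only [add_tmul, smul_add, map_add, hy, hz]
          | tmul p d =>
            rw [hL, hF, hF, hR, smul_smul, smul_smul, ← Algebra.TensorProduct.one_def, mul_comm]
  refine ⟨{ toFun := F, map_add' := map_add F, map_smul' := hsmul, invFun := G,
            left_inv := fun x => ?_, right_inv := fun x => ?_ }⟩
  · induction x with
    | zero => simp
    | add x y hx hy => simp only [map_add] at hx hy ⊢; rw [hx, hy]
    | tmul m e =>
      induction m with
      | zero => simp
      | add m n hm hn => simp only [add_tmul, map_add] at hm hn ⊢; rw [hm, hn]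
      | tmul y q =>
        induction y with
        | zero => simp
        | add y z hy hz => simp only [add_tmul, map_add] at hy hz ⊢; rw [hy, hz]
        | tmul p d => simp only [hF, hG, ← hQ, ← smul_tmul, hPC, one_smul, mul_one]
  · induction x with
    | zero => simp
    | add x y hx hy => simp only [map_add] at hx hy ⊢; rw [hx, hy]
    | tmul p z =>
      induction z with
      | zero => simp
      | add y z hy hz => simp only [tmul_add, map_add] at hy hz ⊢; rw [hy, hz]
      | tmul q e =>
        simp only [hG, hF, ← Algebra.TensorProduct.one_def, one_smul]

end PartialTrace

/-- Let `k` be a field and `R₁, R₂, R₃, C` commutative `k`-algebras.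
For a module `P` over `R₁ ⊗_k R₂`, `Ψ_C(P) = P ⊗_k C` is a module over
`(R₁ ⊗_k C) ⊗_k (R₂ ⊗_k C)` on which both copies of `C` act through the factor `C`.
For a module `Q` over `(R₂ ⊗_k C) ⊗_k (R₃ ⊗_k C)`, `Ψ'_C(Q) = Q ⊗_{C ⊗_k C} C` is a
module over `R₂ ⊗_k R₃` (coequalizing the two `C`-actions).  Then there is a natural
isomorphism `Ψ'_C(Ψ_C(P) ⊗_{R₂ ⊗_k C} Q) ≅ P ⊗_{R₂} Ψ'_C(Q)` of modules over `R₁ ⊗_k R₃`.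

All the intermediate module structures are canonically determined; here they are
universally quantified together with the equations characterizing them on pure tensors
and pure scalars. -/
theorem stmt_15 (k : Type) [Field k]
    (R₁ R₂ R₃ C : Type)
    [CommRing R₁] [Algebra k R₁] [CommRing R₂] [Algebra k R₂]
    [CommRing R₃] [Algebra k R₃] [CommRing C] [Algebra k C]
    (P Q : Type) [AddCommGroup P] [AddCommGroup Q]
    [Module (TensorProduct k R₁ R₂) P]
    [Module (TensorProduct k (TensorProduct k R₂ C) (TensorProduct k R₃ C)) Q] :
    -- the actions of the individual factors on `P`
    letI : Module R₂ P := Module.compHom P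
      (Algebra.TensorProduct.includeRight : R₂ →ₐ[k] TensorProduct k R₁ R₂).toRingHom
    letI : Module R₁ P := Module.compHom P
      (Algebra.TensorProduct.includeLeft : R₁ →ₐ[k] TensorProduct k R₁ R₂).toRingHom
    letI : Module k P := Module.compHom P (algebraMap k (TensorProduct k R₁ R₂))
    -- `R₂ ⊗ C` acts on `Q` through the left inclusion
    letI : Module (TensorProduct k R₂ C) Q := Module.compHom Q
      (Algebra.TensorProduct.includeLeft : TensorProduct k R₂ C →ₐ[k]
        TensorProduct k (TensorProduct k R₂ C) (TensorProduct k R₃ C)).toRingHom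
    -- `C ⊗ C` acts on `Q` through the two `C`-factors
    letI : Module (TensorProduct k C C) Q := Module.compHom Q
      (Algebra.TensorProduct.map
        (Algebra.TensorProduct.includeRight : C →ₐ[k] TensorProduct k R₂ C)
        (Algebra.TensorProduct.includeRight : C →ₐ[k] TensorProduct k R₃ C)).toRingHom
    -- `C ⊗ C` acts on `C` through the multiplication map
    letI : Module (TensorProduct k C C) C := Module.compHom C
      (Algebra.TensorProduct.lmul' k (S := C)).toRingHom
    -- the `R₂ ⊗ C`-module structure on `Ψ_C(P) = P ⊗_k C`
    ∀ (mPC : Module (TensorProduct k R₂ C) (TensorProduct k P C)),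
    letI := mPC
    (∀ (r₂ : R₂) (c : C) (p : P) (d : C),
        (r₂ ⊗ₜ[k] c) • (p ⊗ₜ[k] d) = (r₂ • p) ⊗ₜ[k] (c * d)) →
    -- the `C ⊗ C`-module structure on `Ψ_C(P) ⊗_{R₂ ⊗ C} Q`
    ∀ (mM : Module (TensorProduct k C C)
        (TensorProduct (TensorProduct k R₂ C) (TensorProduct k P C) Q)),
    letI := mM
    (∀ (c c' : C) (p : P) (d : C) (q : Q),
        (c ⊗ₜ[k] c') • ((p ⊗ₜ[k] d) ⊗ₜ[TensorProduct k R₂ C] q)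
          = (p ⊗ₜ[k] (c * d)) ⊗ₜ[TensorProduct k R₂ C]
              ((((1 : R₂) ⊗ₜ[k] (1 : C)) ⊗ₜ[k] ((1 : R₃) ⊗ₜ[k] c')) • q)) →
    -- the `R₁ ⊗ R₃`-module structure on the left-hand side
    ∀ (mL : Module (TensorProduct k R₁ R₃)
        (TensorProduct (TensorProduct k C C)
          (TensorProduct (TensorProduct k R₂ C) (TensorProduct k P C) Q) C)),
    letI := mL
    (∀ (r₁ : R₁) (r₃ : R₃) (p : P) (d : C) (q : Q) (e : C),
        (r₁ ⊗ₜ[k] r₃) •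
            (((p ⊗ₜ[k] d) ⊗ₜ[TensorProduct k R₂ C] q) ⊗ₜ[TensorProduct k C C] e)
          = (((r₁ • p) ⊗ₜ[k] d) ⊗ₜ[TensorProduct k R₂ C]
              ((((1 : R₂) ⊗ₜ[k] (1 : C)) ⊗ₜ[k] (r₃ ⊗ₜ[k] (1 : C))) • q))
              ⊗ₜ[TensorProduct k C C] e) →
    -- the `R₂`-module structure on `Ψ'_C(Q) = Q ⊗_{C ⊗ C} C`
    ∀ (mN : Module R₂ (TensorProduct (TensorProduct k C C) Q C)),
    letI := mN
    (∀ (r₂ : R₂) (q : Q) (e : C),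
        r₂ • (q ⊗ₜ[TensorProduct k C C] e)
          = (((r₂ ⊗ₜ[k] (1 : C)) ⊗ₜ[k] ((1 : R₃) ⊗ₜ[k] (1 : C))) • q)
              ⊗ₜ[TensorProduct k C C] e) →
    -- the `R₁ ⊗ R₃`-module structure on the right-hand side
    ∀ (mR : Module (TensorProduct k R₁ R₃)
        (TensorProduct R₂ P (TensorProduct (TensorProduct k C C) Q C))),
    letI := mR
    (∀ (r₁ : R₁) (r₃ : R₃) (p : P) (q : Q) (e : C),
        (r₁ ⊗ₜ[k] r₃) • (p ⊗ₜ[R₂] (q ⊗ₜ[TensorProduct k C C] e))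
          = (r₁ • p) ⊗ₜ[R₂]
              (((((1 : R₂) ⊗ₜ[k] (1 : C)) ⊗ₜ[k] (r₃ ⊗ₜ[k] (1 : C))) • q)
                ⊗ₜ[TensorProduct k C C] e)) →
    -- the natural isomorphism `Ψ'_C(Ψ_C(P) ⊗ Q) ≅ P ⊗ Ψ'_C(Q)`
    Nonempty
      ((TensorProduct (TensorProduct k C C)
          (TensorProduct (TensorProduct k R₂ C) (TensorProduct k P C) Q) C)
        ≃ₗ[TensorProduct k R₁ R₃]
        (TensorProduct R₂ P (TensorProduct (TensorProduct k C C) Q C))) := by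
  intro mPC hPC mM hM mL hL mN hN mR hR
  let : Module R₂ P := Module.compHom P
    (Algebra.TensorProduct.includeRight : R₂ →ₐ[k] R₁ ⊗[k] R₂).toRingHom
  let : Module R₁ P := Module.compHom P
    (Algebra.TensorProduct.includeLeft : R₁ →ₐ[k] R₁ ⊗[k] R₂).toRingHom
  let : Module k P := Module.compHom P (algebraMap k (R₁ ⊗[k] R₂))
  let : Module (R₂ ⊗[k] C) Q := Module.compHom Q
    (Algebra.TensorProduct.includeLeft :
      R₂ ⊗[k] C →ₐ[k] (R₂ ⊗[k] C) ⊗[k] (R₃ ⊗[k] C)).toRingHom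
  let : Module (C ⊗[k] C) Q := Module.compHom Q
    (Algebra.TensorProduct.map
      (Algebra.TensorProduct.includeRight : C →ₐ[k] R₂ ⊗[k] C)
      (Algebra.TensorProduct.includeRight : C →ₐ[k] R₃ ⊗[k] C)).toRingHom
  let : Module (C ⊗[k] C) C := Module.compHom C (Algebra.TensorProduct.lmul' k (S := C)).toRingHom
  refine nonempty_partialTrace_convolution_equiv (fun a p => ?_) (fun _ _ => rfl)
    (fun _ _ _ => rfl) hPC hM hL hN hR
  change algebraMap k (R₁ ⊗[k] R₂) a • p =
    (Algebra.TensorProduct.includeRight : R₂ →ₐ[k] R₁ ⊗[k] R₂) (algebraMap k R₂ a) • p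
  rw [AlgHom.commutes]
end
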